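/- arXiv:2505.04220 — 2 statements merged into one kernel-verified Lean document; each statement's English description precedes it below -/
import Mathlib

section
/- Let e ∈ L \ {0,1}, T a t-norm on [0,e], and int₁, int₂ interior operators on L with int₂(x) ≤ int₁(x) for all x ∈ L \ [0,e]. Define U : L² → L by: U(x,y) = T(x,y) if (x,y) ∈ ]0,e]²; U(x,y) = x if (x,y) ∈ (I_e ∪ ]e,1]) × {e}; U(x,y) = y if (x,y) ∈ {e} × (I_e ∪ ]e,1]); U(x,y) = int₁(x) ∨ (x ∧ e) if (x,y) ∈ ]e,1[ × ]0,e[; U(x,y) = int₁(y) ∨ (y ∧ e) if (x,y) ∈ ]0,e[ × ]e,1[; U(x,y) = int₂(x) ∨ (x ∧ e) if (x,y) ∈ I_e × ]0,e[; U(x,y) = int₂(y) ∨ (y ∧ e) if (x,y) ∈ ]0,e[ × I_e; U(x,y) = 0 if (x,y) ∈ L × {0} ∪ {0} × L; and U(x,y) = 1 otherwise. Then: (1) if int₂(x) ∉ [0,e] for all x ∈ I_e and int₁(x) ∉ [0,e] for all x ∈ ]e,1[, then U is a uninorm on L with neutral element e if and only if 0 < T(x,y) for all x, y ∈ ]0,e[;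 (2) if ]0,e[ ≠ ∅, then U is a uninorm on L with neutral element e if and only if 0 < T(x,y) for all x, y ∈ ]0,e[, int₂(x) ∉ [0,e] for all x ∈ I_e, and int₁(x) ∉ [0,e] for all x ∈ ]e,1[. -/
/-- `Par a b` means that `a` and `b` are incomparable. -/
def Par {L : Type*} [Lattice L] (a b : L) : Prop := ¬ a ≤ b ∧ ¬ b ≤ a

theorem monotone_of_map_inf {L : Type*} [Lattice L] {g : L → L} (hg : ∀ x y, g (x ⊓ y) = g x ⊓ g y) : Monotone g := by
  intro x y h
  have := hg x y
  rw [inf_eq_left.2 h] at this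
  exact left_eq_inf.1 this

theorem interior_sup_inf_idem {L : Type*} [Lattice L] {e : L} {g : L → L} (hle : ∀ x, g x ≤ x)
    (hinf : ∀ x y, g (x ⊓ y) = g x ⊓ g y) (hidem : ∀ x, g (g x) = g x) (x : L) :
    g (g x ⊔ (x ⊓ e)) ⊔ ((g x ⊔ (x ⊓ e)) ⊓ e) = g x ⊔ (x ⊓ e) := by
  apply le_antisymm (sup_le (hle _) inf_le_left)
  apply sup_le_sup
  · calc g x = g (g x) := (hidem x).symm
      _ ≤ _ := monotone_of_map_inf hinf le_sup_left
  · exact le_inf le_sup_right inf_le_right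

section

variable {L : Type*} [Lattice L] [BoundedOrder L]

open Classical in
/-- The common value of `U b a` for `⊥ < a < e` and `b` not below `e`. -/
noncomputable def outerMap (e : L) (int₁ int₂ : L → L) (b : L) : L :=
  if b = ⊤ then ⊤ else if e ≤ b then int₁ b ⊔ (b ⊓ e) else int₂ b ⊔ (b ⊓ e)

theorem eq_bot_or_mem_Ioo_or_eq_or_not_le (e x : L) :
    x = ⊥ ∨ x ∈ Set.Ioo ⊥ e ∨ x = e ∨ ¬ x ≤ e := by
  by_cases h : x ≤ e
  · rcases h.lt_or_eq with h | h
    · rcases (bot_le (a := x)).lt_or_eq with h' | h'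
      · exact Or.inr (Or.inl ⟨h', h⟩)
      · exact Or.inl h'.symm
    · exact Or.inr (Or.inr (Or.inl h))
  · exact Or.inr (Or.inr (Or.inr h))

theorem eq_top_or_mem_Ioo_or_par {e x : L} (h : ¬ x ≤ e) :
    x = ⊤ ∨ x ∈ Set.Ioo e ⊤ ∨ Par x e := by
  by_cases hx : x = ⊤
  · exact Or.inl hx
  · by_cases he : e ≤ x
    · exact Or.inr (Or.inl ⟨lt_of_le_not_ge he h, lt_top_iff_ne_top.2 hx⟩)
    · exact Or.inr (Or.inr ⟨h, he⟩)

theorem outerMap_top (e : L) (int₁ int₂ : L → L) : outerMap e int₁ int₂ ⊤ = ⊤ := by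
  simp [outerMap]

theorem outerMap_of_mem_Ioo {e x : L} (int₁ int₂ : L → L) (hx : x ∈ Set.Ioo e ⊤) :
    outerMap e int₁ int₂ x = int₁ x ⊔ (x ⊓ e) := by
  simp [outerMap, hx.2.ne, hx.1.le]

theorem outerMap_of_par {e x : L} (int₁ int₂ : L → L) (hx : Par x e) :
    outerMap e int₁ int₂ x = int₂ x ⊔ (x ⊓ e) := by
  have : x ≠ ⊤ := fun h => hx.2 (h ▸ le_top)
  simp [outerMap, this, hx.2]

theorem outerMap_le {e : L} {int₁ int₂ : L → L} (h₁ : ∀ x, int₁ x ≤ x) (h₂ : ∀ x, int₂ x ≤ x)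
    (x : L) : outerMap e int₁ int₂ x ≤ x := by
  unfold outerMap
  split_ifs with h h'
  · exact h.ge
  · exact sup_le (h₁ x) inf_le_left
  · exact sup_le (h₂ x) inf_le_left

theorem inf_le_outerMap (e : L) (int₁ int₂ : L → L) (x : L) :
    x ⊓ e ≤ outerMap e int₁ int₂ x := by
  unfold outerMap
  split_ifs
  · exact le_top
  · exact le_sup_right
  · exact le_sup_right

theorem outerMap_mono {e : L} {int₁ int₂ : L → L} (h₁ : Monotone int₁) (h₂ : Monotone int₂)
    (h₂₁ : ∀ x, x ∉ Set.Icc ⊥ e → int₂ x ≤ int₁ x) {x y : L} (hx : ¬ x ≤ e) (hxy : x ≤ y) :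
    outerMap e int₁ int₂ x ≤ outerMap e int₁ int₂ y := by
  have hinf : x ⊓ e ≤ y ⊓ e := inf_le_inf_right e hxy
  unfold outerMap
  split_ifs with hx₁ hy₁
  · exact le_rfl
  · exact absurd (top_le_iff.1 (hx₁ ▸ hxy)) hy₁
  · exact absurd (top_le_iff.1 (hx₁ ▸ hxy)) hy₁
  · exact le_top
  · exact sup_le_sup (h₁ hxy) hinf
  · exact absurd (le_trans ‹e ≤ x› hxy) ‹_›
  · exact le_top
  · exact sup_le_sup ((h₂₁ x fun h => hx h.2).trans (h₁ hxy)) hinf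
  · exact sup_le_sup (h₂ hxy) hinf

theorem outerMap_not_le {e : L} {int₁ int₂ : L → L} (he : e ≠ ⊤)
    (hI₂ : ∀ x, Par x e → int₂ x ∉ Set.Icc ⊥ e) (hI₁ : ∀ x ∈ Set.Ioo e ⊤, int₁ x ∉ Set.Icc ⊥ e)
    {x : L} (hx : ¬ x ≤ e) : ¬ outerMap e int₁ int₂ x ≤ e := by
  intro h
  rcases eq_top_or_mem_Ioo_or_par hx with rfl | hx | hx
  · rw [outerMap_top] at h
    exact he (top_le_iff.1 h)
  · rw [outerMap_of_mem_Ioo _ _ hx] at h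
    exact hI₁ x hx ⟨bot_le, le_sup_left.trans h⟩
  · rw [outerMap_of_par _ _ hx] at h
    exact hI₂ x hx ⟨bot_le, le_sup_left.trans h⟩

theorem outerMap_idem {e : L} {int₁ int₂ : L → L} (he : e ≠ ⊤)
    (hI₂ : ∀ x, Par x e → int₂ x ∉ Set.Icc ⊥ e) (hI₁ : ∀ x ∈ Set.Ioo e ⊤, int₁ x ∉ Set.Icc ⊥ e)
    (hint₁_le : ∀ x, int₁ x ≤ x) (hint₁_inf : ∀ x y, int₁ (x ⊓ y) = int₁ x ⊓ int₁ y)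
    (hint₁_idem : ∀ x, int₁ (int₁ x) = int₁ x)
    (hint₂_le : ∀ x, int₂ x ≤ x) (hint₂_inf : ∀ x y, int₂ (x ⊓ y) = int₂ x ⊓ int₂ y)
    (hint₂_idem : ∀ x, int₂ (int₂ x) = int₂ x) {x : L} (hx : ¬ x ≤ e) :
    outerMap e int₁ int₂ (outerMap e int₁ int₂ x) = outerMap e int₁ int₂ x := by
  have hB := outerMap_not_le he hI₂ hI₁ hx
  have hle := outerMap_le (e := e) hint₁_le hint₂_le x
  rcases eq_top_or_mem_Ioo_or_par hx with rfl | hx | hx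
  · simp only [outerMap_top]
  · have hm : outerMap e int₁ int₂ x ∈ Set.Ioo e ⊤ := by
      refine ⟨lt_of_le_not_ge ?_ hB, hle.trans_lt hx.2⟩
      have := inf_le_outerMap e int₁ int₂ x
      rwa [inf_eq_right.2 hx.1.le] at this
    rw [outerMap_of_mem_Ioo _ _ hm, outerMap_of_mem_Ioo _ _ hx]
    exact interior_sup_inf_idem hint₁_le hint₁_inf hint₁_idem x
  · have hm : Par (outerMap e int₁ int₂ x) e := ⟨hB, fun h => hx.2 (h.trans hle)⟩
    rw [outerMap_of_par _ _ hm, outerMap_of_par _ _ hx]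
    exact interior_sup_inf_idem hint₂_le hint₂_inf hint₂_idem x

/-- An operation on `L` that is given by a positive t-norm `T` on `[⊥, e]`, by an idempotent map `f`
of `{b | ¬ b ≤ e}` on the mixed pairs, and by `⊤` outside, is a uninorm. -/
theorem uninorm_of_outer_map {e : L} {T U : L → L → L} {f : L → L} (he1 : e ≠ ⊤)
    (hT_le : ∀ x ∈ Set.Ioo ⊥ e, ∀ y ∈ Set.Ioo ⊥ e, T x y ≤ x)
    (hT_comm : ∀ x ∈ Set.Ioo ⊥ e, ∀ y ∈ Set.Ioo ⊥ e, T x y = T y x)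
    (hT_assoc : ∀ x ∈ Set.Ioo ⊥ e, ∀ y ∈ Set.Ioo ⊥ e, ∀ z ∈ Set.Ioo ⊥ e,
      T (T x y) z = T x (T y z))
    (hT_mono : ∀ x ∈ Set.Ioo ⊥ e, ∀ y ∈ Set.Ioo ⊥ e, ∀ z ∈ Set.Ioo ⊥ e, x ≤ y → T x z ≤ T y z)
    (hT_pos : ∀ x ∈ Set.Ioo ⊥ e, ∀ y ∈ Set.Ioo ⊥ e, ⊥ < T x y)
    (hf_le : ∀ x, f x ≤ x) (hf_inf : ∀ x, x ⊓ e ≤ f x)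
    (hf_mono : ∀ x y, ¬ x ≤ e → x ≤ y → f x ≤ f y)
    (hf_not_le : ∀ x, ¬ x ≤ e → ¬ f x ≤ e) (hf_idem : ∀ x, ¬ x ≤ e → f (f x) = f x)
    (hf_top : f ⊤ = ⊤)
    (hU_bot_left : ∀ y, U ⊥ y = ⊥) (hU_bot_right : ∀ x, U x ⊥ = ⊥)
    (hU_e_left : ∀ x, U e x = x) (hU_e_right : ∀ x, U x e = x)
    (hU_in_in : ∀ x ∈ Set.Ioo ⊥ e, ∀ y ∈ Set.Ioo ⊥ e, U x y = T x y)
    (hU_in_out : ∀ x ∈ Set.Ioo ⊥ e, ∀ y, ¬ y ≤ e → U x y = f y)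
    (hU_out_in : ∀ x, ¬ x ≤ e → ∀ y ∈ Set.Ioo ⊥ e, U x y = f x)
    (hU_out_out : ∀ x y, ¬ x ≤ e → ¬ y ≤ e → U x y = ⊤) :
    (∀ x y, U x y = U y x) ∧ (∀ x y z, U (U x y) z = U x (U y z)) ∧
      (∀ x y z, x ≤ y → U x z ≤ U y z) ∧ (∀ x y z, x ≤ y → U z x ≤ U z y) ∧
      (∀ x, U e x = x) := by
  have htop : ¬ (⊤ : L) ≤ e := fun h => he1 (top_le_iff.1 h)
  have hTA : ∀ x ∈ Set.Ioo ⊥ e, ∀ y ∈ Set.Ioo ⊥ e, T x y ∈ Set.Ioo ⊥ e := fun x hx y hy =>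
    ⟨hT_pos x hx y hy, (hT_le x hx y hy).trans_lt hx.2⟩
  have hcomm : ∀ x y, U x y = U y x := by
    intro x y
    rcases eq_bot_or_mem_Ioo_or_eq_or_not_le e x with rfl | hx | rfl | hx
    · rw [hU_bot_left, hU_bot_right]
    · rcases eq_bot_or_mem_Ioo_or_eq_or_not_le e y with rfl | hy | rfl | hy
      · rw [hU_bot_left, hU_bot_right]
      · rw [hU_in_in x hx y hy, hU_in_in y hy x hx, hT_comm x hx y hy]
      · rw [hU_e_left, hU_e_right]
      · rw [hU_in_out x hx y hy, hU_out_in y hy x hx]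
    · rw [hU_e_left, hU_e_right]
    · rcases eq_bot_or_mem_Ioo_or_eq_or_not_le e y with rfl | hy | rfl | hy
      · rw [hU_bot_left, hU_bot_right]
      · rw [hU_in_out y hy x hx, hU_out_in x hx y hy]
      · rw [hU_e_left, hU_e_right]
      · rw [hU_out_out x y hx hy, hU_out_out y x hy hx]
  have hmono : ∀ x y z, x ≤ y → U x z ≤ U y z := by
    intro x y z hxy
    rcases eq_bot_or_mem_Ioo_or_eq_or_not_le e z with rfl | hz | rfl | hz
    · rw [hU_bot_right, hU_bot_right]
    · rcases eq_bot_or_mem_Ioo_or_eq_or_not_le e x with rfl | hx | rfl | hx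
      · rw [hU_bot_left]
        exact bot_le
      · rw [hU_in_in x hx z hz]
        rcases eq_bot_or_mem_Ioo_or_eq_or_not_le e y with rfl | hy | rfl | hy
        · exact absurd hx.1 hxy.not_gt
        · rw [hU_in_in y hy z hz]
          exact hT_mono x hx y hy z hz hxy
        · rw [hU_e_left, hT_comm x hx z hz]
          exact hT_le z hz x hx
        · rw [hU_out_in y hy z hz]
          exact (hT_le x hx z hz).trans ((le_inf hxy hx.2.le).trans (hf_inf y))
      · rw [hU_e_left]
        rcases eq_bot_or_mem_Ioo_or_eq_or_not_le x y with rfl | hy | rfl | hy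
        · exact absurd (hz.1.trans hz.2) hxy.not_gt
        · exact absurd hy.2 hxy.not_gt
        · rw [hU_e_left]
        · rw [hU_out_in y hy z hz]
          exact (le_inf (hz.2.le.trans hxy) hz.2.le).trans (hf_inf y)
      · rw [hU_out_in x hx z hz, hU_out_in y (fun h => hx (hxy.trans h)) z hz]
        exact hf_mono x y hx hxy
    · rwa [hU_e_right, hU_e_right]
    · rcases eq_bot_or_mem_Ioo_or_eq_or_not_le e y with rfl | hy | rfl | hy
      · rw [le_bot_iff.1 hxy]
      · rcases eq_bot_or_mem_Ioo_or_eq_or_not_le e x with rfl | hx | rfl | hx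
        · rw [hU_bot_left]
          exact bot_le
        · rw [hU_in_out x hx z hz, hU_in_out y hy z hz]
        · exact absurd hy.2 hxy.not_gt
        · exact absurd (hxy.trans hy.2.le) hx
      · rcases eq_bot_or_mem_Ioo_or_eq_or_not_le y x with rfl | hx | rfl | hx
        · rw [hU_bot_left]
          exact bot_le
        · rw [hU_in_out x hx z hz, hU_e_left]
          exact hf_le z
        · exact le_rfl
        · exact absurd hxy hx
      · rw [hU_out_out y z hy hz]
        exact le_top
  refine ⟨hcomm, ?_, hmono, fun x y z h => ?_, hU_e_left⟩
  · intro x y z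
    rcases eq_bot_or_mem_Ioo_or_eq_or_not_le e x with rfl | hx | rfl | hx
    · simp only [hU_bot_left]
    · rcases eq_bot_or_mem_Ioo_or_eq_or_not_le e y with rfl | hy | rfl | hy
      · simp only [hU_bot_left, hU_bot_right]
      · rcases eq_bot_or_mem_Ioo_or_eq_or_not_le e z with rfl | hz | rfl | hz
        · simp only [hU_bot_right]
        · rw [hU_in_in x hx y hy, hU_in_in y hy z hz, hU_in_in _ (hTA x hx y hy) z hz,
            hU_in_in x hx _ (hTA y hy z hz), hT_assoc x hx y hy z hz]
        · simp only [hU_e_right]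
        · rw [hU_in_in x hx y hy, hU_in_out _ (hTA x hx y hy) z hz, hU_in_out y hy z hz,
            hU_in_out x hx _ (hf_not_le z hz), hf_idem z hz]
      · simp only [hU_e_right, hU_e_left]
      · rw [hU_in_out x hx y hy]
        have hfy := hf_not_le y hy
        rcases eq_bot_or_mem_Ioo_or_eq_or_not_le e z with rfl | hz | rfl | hz
        · simp only [hU_bot_right]
        · rw [hU_out_in _ hfy z hz, hU_out_in y hy z hz, hU_in_out x hx _ hfy]
        · rw [hU_e_right, hU_e_right, hU_in_out x hx y hy]
        · rw [hU_out_out _ z hfy hz, hU_out_out y z hy hz, hU_in_out x hx _ htop, hf_top]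
    · simp only [hU_e_left]
    · rcases eq_bot_or_mem_Ioo_or_eq_or_not_le e y with rfl | hy | rfl | hy
      · simp only [hU_bot_left, hU_bot_right]
      · rw [hU_out_in x hx y hy]
        have hfx := hf_not_le x hx
        rcases eq_bot_or_mem_Ioo_or_eq_or_not_le e z with rfl | hz | rfl | hz
        · simp only [hU_bot_right]
        · rw [hU_out_in _ hfx z hz, hU_in_in y hy z hz, hU_out_in x hx _ (hTA y hy z hz),
            hf_idem x hx]
        · rw [hU_e_right, hU_e_right, hU_out_in x hx y hy]
        · rw [hU_out_out _ z hfx hz, hU_in_out y hy z hz, hU_out_out x _ hx (hf_not_le z hz)]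
      · simp only [hU_e_right, hU_e_left]
      · rw [hU_out_out x y hx hy]
        rcases eq_bot_or_mem_Ioo_or_eq_or_not_le e z with rfl | hz | rfl | hz
        · simp only [hU_bot_right]
        · rw [hU_out_in _ htop z hz, hU_out_in y hy z hz, hU_out_out x _ hx (hf_not_le y hy), hf_top]
        · rw [hU_e_right, hU_e_right, hU_out_out x y hx hy]
        · rw [hU_out_out _ z htop hz, hU_out_out y z hy hz, hU_out_out x _ hx htop]
  · rw [hcomm z x, hcomm z y]
    exact hmono x y z h

end

theorem uninorm_two_interior_bot_iff {L : Type*} [Lattice L] [BoundedOrder L]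
    (e : L) (he0 : e ≠ ⊥) (he1 : e ≠ ⊤)
    (T : L → L → L)
    (hT_mem : ∀ x ∈ Set.Icc ⊥ e, ∀ y ∈ Set.Icc ⊥ e, T x y ∈ Set.Icc ⊥ e)
    (hT_comm : ∀ x ∈ Set.Icc ⊥ e, ∀ y ∈ Set.Icc ⊥ e, T x y = T y x)
    (hT_assoc : ∀ x ∈ Set.Icc ⊥ e, ∀ y ∈ Set.Icc ⊥ e, ∀ z ∈ Set.Icc ⊥ e, T (T x y) z = T x (T y z))
    (hT_mono₁ : ∀ x ∈ Set.Icc ⊥ e, ∀ y ∈ Set.Icc ⊥ e, ∀ z ∈ Set.Icc ⊥ e, x ≤ y → T x z ≤ T y z)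
    (hT_mono₂ : ∀ x ∈ Set.Icc ⊥ e, ∀ y ∈ Set.Icc ⊥ e, ∀ z ∈ Set.Icc ⊥ e, x ≤ y → T z x ≤ T z y)
    (hT_unit : ∀ x ∈ Set.Icc ⊥ e, T e x = x)
    (int₁ int₂ : L → L)
    (hint₁_le : ∀ x, int₁ x ≤ x)
    (hint₁_inf : ∀ x y, int₁ (x ⊓ y) = int₁ x ⊓ int₁ y)
    (hint₁_idem : ∀ x, int₁ (int₁ x) = int₁ x)
    (hint₂_le : ∀ x, int₂ x ≤ x)
    (hint₂_inf : ∀ x y, int₂ (x ⊓ y) = int₂ x ⊓ int₂ y)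
    (hint₂_idem : ∀ x, int₂ (int₂ x) = int₂ x)
    (hint₂₁ : ∀ x, x ∉ Set.Icc ⊥ e → int₂ x ≤ int₁ x)
    (U : L → L → L)
    (hU1 : ∀ x y, x ∈ Set.Ioc ⊥ e ∧ y ∈ Set.Ioc ⊥ e → U x y = T x y)
    (hU2 : ∀ x y, (Par x e ∨ x ∈ Set.Ioc e ⊤) ∧ y = e → U x y = x)
    (hU3 : ∀ x y, x = e ∧ (Par y e ∨ y ∈ Set.Ioc e ⊤) → U x y = y)
    (hU4 : ∀ x y, x ∈ Set.Ioo e ⊤ ∧ y ∈ Set.Ioo ⊥ e → U x y = int₁ x ⊔ (x ⊓ e))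
    (hU5 : ∀ x y, x ∈ Set.Ioo ⊥ e ∧ y ∈ Set.Ioo e ⊤ → U x y = int₁ y ⊔ (y ⊓ e))
    (hU6 : ∀ x y, Par x e ∧ y ∈ Set.Ioo ⊥ e → U x y = int₂ x ⊔ (x ⊓ e))
    (hU7 : ∀ x y, x ∈ Set.Ioo ⊥ e ∧ Par y e → U x y = int₂ y ⊔ (y ⊓ e))
    (hU8 : ∀ x y, x = ⊥ ∨ y = ⊥ → U x y = ⊥)
    (hU0 : ∀ x y, ¬(x ∈ Set.Ioc ⊥ e ∧ y ∈ Set.Ioc ⊥ e) → ¬((Par x e ∨ x ∈ Set.Ioc e ⊤) ∧ y = e) → ¬(x = e ∧ (Par y e ∨ y ∈ Set.Ioc e ⊤)) → ¬(x ∈ Set.Ioo e ⊤ ∧ y ∈ Set.Ioo ⊥ e) → ¬(x ∈ Set.Ioo ⊥ e ∧ y ∈ Set.Ioo e ⊤) → ¬(Par x e ∧ y ∈ Set.Ioo ⊥ e) → ¬(x ∈ Set.Ioo ⊥ e ∧ Par y e) → ¬(x = ⊥ ∨ y = ⊥) → U x y = ⊤)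
    :
    (((∀ x, Par x e → int₂ x ∉ Set.Icc ⊥ e) ∧ (∀ x ∈ Set.Ioo e ⊤, int₁ x ∉ Set.Icc ⊥ e)) →
        (((∀ x y, U x y = U y x) ∧ (∀ x y z, U (U x y) z = U x (U y z)) ∧
      (∀ x y z, x ≤ y → U x z ≤ U y z) ∧ (∀ x y z, x ≤ y → U z x ≤ U z y) ∧
      (∀ x, U e x = x)) ↔ (∀ x ∈ Set.Ioo ⊥ e, ∀ y ∈ Set.Ioo ⊥ e, ⊥ < T x y))) ∧
    ((Set.Ioo ⊥ e).Nonempty →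
        (((∀ x y, U x y = U y x) ∧ (∀ x y z, U (U x y) z = U x (U y z)) ∧
      (∀ x y z, x ≤ y → U x z ≤ U y z) ∧ (∀ x y z, x ≤ y → U z x ≤ U z y) ∧
      (∀ x, U e x = x)) ↔ ((∀ x ∈ Set.Ioo ⊥ e, ∀ y ∈ Set.Ioo ⊥ e, ⊥ < T x y) ∧ ((∀ x, Par x e → int₂ x ∉ Set.Icc ⊥ e) ∧ (∀ x ∈ Set.Ioo e ⊤, int₁ x ∉ Set.Icc ⊥ e))))) := by
  have htop : ¬ (⊤ : L) ≤ e := fun h => he1 (top_le_iff.1 h)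
  have heI : e ∈ Set.Icc ⊥ e := ⟨bot_le, le_rfl⟩
  have heC : e ∈ Set.Ioc ⊥ e := ⟨bot_lt_iff_ne_bot.2 he0, le_rfl⟩
  have hIoc : ∀ {x : L}, x ∈ Set.Ioo ⊥ e → x ∈ Set.Ioc ⊥ e := fun h => ⟨h.1, h.2.le⟩
  have hIcc : ∀ {x : L}, x ∈ Set.Ioo ⊥ e → x ∈ Set.Icc ⊥ e := fun h => ⟨h.1.le, h.2.le⟩
  have hout : ∀ {x : L}, ¬ x ≤ e → Par x e ∨ x ∈ Set.Ioc e ⊤ := by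
    intro x hx
    by_cases h : e ≤ x
    · exact Or.inr ⟨lt_of_le_not_ge h hx, le_top⟩
    · exact Or.inl ⟨hx, h⟩
  have hne : ∀ {x : L}, ¬ x ≤ e → x ≠ ⊥ ∧ x ≠ e := fun hx =>
    ⟨fun h => hx (h ▸ bot_le), fun h => hx h.le⟩
  have hT_unit_right : ∀ x ∈ Set.Icc ⊥ e, T x e = x := fun x hx => by
    rw [hT_comm x hx e heI, hT_unit x hx]
  have hU_bot_left : ∀ y, U ⊥ y = ⊥ := fun y => hU8 _ _ (Or.inl rfl)
  have hU_bot_right : ∀ x, U x ⊥ = ⊥ := fun x => hU8 _ _ (Or.inr rfl)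
  have hU_e_left : ∀ x, U e x = x := by
    intro x
    rcases eq_bot_or_mem_Ioo_or_eq_or_not_le e x with rfl | hx | rfl | hx
    · exact hU_bot_right e
    · rw [hU1 e x ⟨heC, hIoc hx⟩, hT_unit x (hIcc hx)]
    · rw [hU1 x x ⟨heC, heC⟩, hT_unit x heI]
    · exact hU3 e x ⟨rfl, hout hx⟩
  have hU_e_right : ∀ x, U x e = x := by
    intro x
    rcases eq_bot_or_mem_Ioo_or_eq_or_not_le e x with rfl | hx | rfl | hx
    · exact hU_bot_left e
    · rw [hU1 x e ⟨hIoc hx, heC⟩, hT_unit_right x (hIcc hx)]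
    · exact hU_e_left x
    · exact hU2 x e ⟨hout hx, rfl⟩
  have hU_in_in : ∀ x ∈ Set.Ioo ⊥ e, ∀ y ∈ Set.Ioo ⊥ e, U x y = T x y := fun x hx y hy =>
    hU1 x y ⟨hIoc hx, hIoc hy⟩
  have hU_in_out : ∀ x ∈ Set.Ioo ⊥ e, ∀ y, ¬ y ≤ e → U x y = outerMap e int₁ int₂ y := by
    intro x hx y hy
    rcases eq_top_or_mem_Ioo_or_par hy with rfl | hy | hy
    · rw [outerMap_top]
      apply hU0
      · exact fun h => hy h.2.2
      · exact fun h => he1 h.2.symm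
      · exact fun h => hx.2.ne h.1
      · exact fun h => hx.2.not_gt h.1.1
      · exact fun h => h.2.2.ne rfl
      · exact fun h => h.1.1 hx.2.le
      · exact fun h => h.2.2 le_top
      · rintro (h | h)
        · exact hx.1.ne' h
        · exact (hne hy).1 h
    · rw [outerMap_of_mem_Ioo _ _ hy]
      exact hU5 x y ⟨hx, hy⟩
    · rw [outerMap_of_par _ _ hy]
      exact hU7 x y ⟨hx, hy⟩
  have hU_out_in : ∀ x, ¬ x ≤ e → ∀ y ∈ Set.Ioo ⊥ e, U x y = outerMap e int₁ int₂ x := by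
    intro x hx y hy
    rcases eq_top_or_mem_Ioo_or_par hx with rfl | hx | hx
    · rw [outerMap_top]
      apply hU0
      · exact fun h => hx h.1.2
      · exact fun h => hy.2.ne h.2
      · exact fun h => he1 h.1.symm
      · exact fun h => h.1.2.ne rfl
      · exact fun h => hy.2.not_gt h.2.1
      · exact fun h => h.1.2 le_top
      · exact fun h => h.2.1 hy.2.le
      · rintro (h | h)
        · exact (hne hx).1 h
        · exact hy.1.ne' h
    · rw [outerMap_of_mem_Ioo _ _ hx]
      exact hU4 x y ⟨hx, hy⟩
    · rw [outerMap_of_par _ _ hx]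
      exact hU6 x y ⟨hx, hy⟩
  have hU_out_out : ∀ x y, ¬ x ≤ e → ¬ y ≤ e → U x y = ⊤ := by
    intro x y hx hy
    apply hU0
    · exact fun h => hx h.1.2
    · exact fun h => (hne hy).2 h.2
    · exact fun h => (hne hx).2 h.1
    · exact fun h => hy h.2.2.le
    · exact fun h => hx h.1.2.le
    · exact fun h => hy h.2.2.le
    · exact fun h => hx h.1.2.le
    · rintro (h | h)
      · exact (hne hx).1 h
      · exact (hne hy).1 h
  have hsuff := fun (hpos : ∀ x ∈ Set.Ioo ⊥ e, ∀ y ∈ Set.Ioo ⊥ e, ⊥ < T x y)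
      (hI₂ : ∀ x, Par x e → int₂ x ∉ Set.Icc ⊥ e)
      (hI₁ : ∀ x ∈ Set.Ioo e ⊤, int₁ x ∉ Set.Icc ⊥ e) =>
    uninorm_of_outer_map (f := outerMap e int₁ int₂) he1
      (fun x hx y hy => (hT_mono₂ y (hIcc hy) e heI x (hIcc hx) hy.2.le).trans_eq
        (hT_unit_right x (hIcc hx)))
      (fun x hx y hy => hT_comm x (hIcc hx) y (hIcc hy))
      (fun x hx y hy z hz => hT_assoc x (hIcc hx) y (hIcc hy) z (hIcc hz))
      (fun x hx y hy z hz => hT_mono₁ x (hIcc hx) y (hIcc hy) z (hIcc hz))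
      hpos (outerMap_le hint₁_le hint₂_le) (inf_le_outerMap e int₁ int₂)
      (fun x y hx hxy => outerMap_mono (monotone_of_map_inf hint₁_inf)
        (monotone_of_map_inf hint₂_inf) hint₂₁ hx hxy)
      (fun x hx => outerMap_not_le he1 hI₂ hI₁ hx)
      (fun x hx => outerMap_idem he1 hI₂ hI₁ hint₁_le hint₁_inf hint₁_idem
        hint₂_le hint₂_inf hint₂_idem hx)
      (outerMap_top e int₁ int₂) hU_bot_left hU_bot_right hU_e_left hU_e_right
      hU_in_in hU_in_out hU_out_in hU_out_out
  have hU_top : ∀ x ∈ Set.Ioo ⊥ e, U x ⊤ = ⊤ := fun x hx => by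
    rw [hU_in_out x hx ⊤ htop, outerMap_top]
  have hbot_ne_top : (⊥ : L) ≠ ⊤ := fun h => htop (h ▸ bot_le)
  have hpos_of_assoc : (∀ x y z, U (U x y) z = U x (U y z)) →
      ∀ x ∈ Set.Ioo ⊥ e, ∀ y ∈ Set.Ioo ⊥ e, ⊥ < T x y := by
    intro hassoc x hx y hy
    refine bot_lt_iff_ne_bot.2 fun h => hbot_ne_top ?_
    have := hassoc x y ⊤
    rwa [hU_in_in x hx y hy, h, hU_bot_left, hU_top y hy, hU_top x hx] at this
  refine ⟨fun hI => ⟨fun h => hpos_of_assoc h.2.1, fun h => hsuff h hI.1 hI.2⟩, ?_⟩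
  rintro ⟨a, ha⟩
  refine ⟨fun h => ?_, fun h => hsuff h.1 h.2.1 h.2.2⟩
  have hkey : ∀ x, ¬ x ≤ e → U x (outerMap e int₁ int₂ x) = ⊤ := by
    intro x hx
    have := h.2.1 x x a
    rw [hU_out_out x x hx hx, hU_out_in ⊤ htop a ha, outerMap_top, hU_out_in x hx a ha] at this
    exact this.symm
  refine ⟨hpos_of_assoc h.2.1, fun x hx hmem => ?_, fun x hx hmem => ?_⟩
  · have hk := hkey x hx.1
    have hle : outerMap e int₁ int₂ x ≤ e := by
      rw [outerMap_of_par _ _ hx]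
      exact sup_le hmem.2 inf_le_right
    rcases eq_bot_or_mem_Ioo_or_eq_or_not_le e (outerMap e int₁ int₂ x) with h' | h' | h' | h'
    · rw [h', hU_bot_right] at hk
      exact hbot_ne_top hk
    · rw [hU_out_in x hx.1 _ h'] at hk
      exact htop (hk ▸ hle)
    · exact hx.2 (h' ▸ outerMap_le hint₁_le hint₂_le x)
    · exact h' hle
  · have hk := hkey x hx.1.not_ge
    rw [outerMap_of_mem_Ioo _ _ hx, inf_eq_right.2 hx.1.le, sup_eq_right.2 hmem.2,
      hU_e_right] at hk
    exact hx.2.ne hk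
end

section
/- Let U be the uninorm constructed in Theorem 3.25 (the piecewise operation built from a t-norm T on [0,e] with 0 < T(x,y) for all x,y ∈ ]0,e[ and interior operators int₂ ≤ int₁ on L \ [0,e] with int₂(x) ∉ [0,e] for all x ∈ I_e and int₁(x) ∉ [0,e] for all x ∈ ]e,1[, taking value 0 on L × {0} ∪ {0} × L). If ]e,1[ contains at most one element and I_e contains at most one element, or if any two distinct elements of ]e,1[ are incomparable and any two distinct elements of I_e are incomparable, then U belongs to the class U_max^0, i.e., U(x,y) = y for all (x,y) ∈ ]0,e[ × (L \ [0,e]) and U(0,y) = 0 for all y ∈ L \ [0,e]. -/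
theorem uninorm_two_interior_bot_Umax_zero {L : Type*} [Lattice L] [BoundedOrder L]
    (e : L) (he0 : e ≠ ⊥) (he1 : e ≠ ⊤)
    (T : L → L → L)
    (hT_mem : ∀ x ∈ Set.Icc ⊥ e, ∀ y ∈ Set.Icc ⊥ e, T x y ∈ Set.Icc ⊥ e)
    (hT_comm : ∀ x ∈ Set.Icc ⊥ e, ∀ y ∈ Set.Icc ⊥ e, T x y = T y x)
    (hT_assoc : ∀ x ∈ Set.Icc ⊥ e, ∀ y ∈ Set.Icc ⊥ e, ∀ z ∈ Set.Icc ⊥ e, T (T x y) z = T x (T y z))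
    (hT_mono₁ : ∀ x ∈ Set.Icc ⊥ e, ∀ y ∈ Set.Icc ⊥ e, ∀ z ∈ Set.Icc ⊥ e, x ≤ y → T x z ≤ T y z)
    (hT_mono₂ : ∀ x ∈ Set.Icc ⊥ e, ∀ y ∈ Set.Icc ⊥ e, ∀ z ∈ Set.Icc ⊥ e, x ≤ y → T z x ≤ T z y)
    (hT_unit : ∀ x ∈ Set.Icc ⊥ e, T e x = x)
    (int₁ int₂ : L → L)
    (hint₁_le : ∀ x, int₁ x ≤ x)
    (hint₁_inf : ∀ x y, int₁ (x ⊓ y) = int₁ x ⊓ int₁ y)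
    (hint₁_idem : ∀ x, int₁ (int₁ x) = int₁ x)
    (hint₂_le : ∀ x, int₂ x ≤ x)
    (hint₂_inf : ∀ x y, int₂ (x ⊓ y) = int₂ x ⊓ int₂ y)
    (hint₂_idem : ∀ x, int₂ (int₂ x) = int₂ x)
    (hint₂₁ : ∀ x, x ∉ Set.Icc ⊥ e → int₂ x ≤ int₁ x)
    (U : L → L → L)
    (hU1 : ∀ x y, x ∈ Set.Ioc ⊥ e ∧ y ∈ Set.Ioc ⊥ e → U x y = T x y)
    (hU2 : ∀ x y, (Par x e ∨ x ∈ Set.Ioc e ⊤) ∧ y = e → U x y = x)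
    (hU3 : ∀ x y, x = e ∧ (Par y e ∨ y ∈ Set.Ioc e ⊤) → U x y = y)
    (hU4 : ∀ x y, x ∈ Set.Ioo e ⊤ ∧ y ∈ Set.Ioo ⊥ e → U x y = int₁ x ⊔ (x ⊓ e))
    (hU5 : ∀ x y, x ∈ Set.Ioo ⊥ e ∧ y ∈ Set.Ioo e ⊤ → U x y = int₁ y ⊔ (y ⊓ e))
    (hU6 : ∀ x y, Par x e ∧ y ∈ Set.Ioo ⊥ e → U x y = int₂ x ⊔ (x ⊓ e))
    (hU7 : ∀ x y, x ∈ Set.Ioo ⊥ e ∧ Par y e → U x y = int₂ y ⊔ (y ⊓ e))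
    (hU8 : ∀ x y, x = ⊥ ∨ y = ⊥ → U x y = ⊥)
    (hU0 : ∀ x y, ¬(x ∈ Set.Ioc ⊥ e ∧ y ∈ Set.Ioc ⊥ e) → ¬((Par x e ∨ x ∈ Set.Ioc e ⊤) ∧ y = e) → ¬(x = e ∧ (Par y e ∨ y ∈ Set.Ioc e ⊤)) → ¬(x ∈ Set.Ioo e ⊤ ∧ y ∈ Set.Ioo ⊥ e) → ¬(x ∈ Set.Ioo ⊥ e ∧ y ∈ Set.Ioo e ⊤) → ¬(Par x e ∧ y ∈ Set.Ioo ⊥ e) → ¬(x ∈ Set.Ioo ⊥ e ∧ Par y e) → ¬(x = ⊥ ∨ y = ⊥) → U x y = ⊤)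
    (hTpos : ∀ x ∈ Set.Ioo ⊥ e, ∀ y ∈ Set.Ioo ⊥ e, ⊥ < T x y)
    (hint₂cond : ∀ x, Par x e → int₂ x ∉ Set.Icc ⊥ e)
    (hint₁cond : ∀ x ∈ Set.Ioo e ⊤, int₁ x ∉ Set.Icc ⊥ e)
    (hsmall : ((Set.Ioo e ⊤).Subsingleton ∧ {x : L | Par x e}.Subsingleton) ∨
      ((∀ x ∈ Set.Ioo e ⊤, ∀ y ∈ Set.Ioo e ⊤, x ≠ y → Par x y) ∧
        (∀ x y, Par x e → Par y e → x ≠ y → Par x y)))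
    :
    (∀ x ∈ Set.Ioo ⊥ e, ∀ y, y ∉ Set.Icc ⊥ e → U x y = y) ∧
      (∀ y, y ∉ Set.Icc ⊥ e → U ⊥ y = ⊥) := by
  have antichain_Ioo : ∀ a ∈ Set.Ioo e ⊤, ∀ b ∈ Set.Ioo e ⊤, a ≤ b → a = b := by
    intro a ha b hb hab
    rcases hsmall with h | h
    · exact h.1 ha hb
    · by_contra hne
      exact (h.1 a ha b hb hne).1 hab
  have antichain_Par : ∀ a b, Par a e → Par b e → a ≤ b → a = b := by
    intro a b ha hb hab
    rcases hsmall with h | h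
    · exact h.2 ha hb
    · by_contra hne
      exact (h.2 a b ha hb hne).1 hab
  refine ⟨fun x hx y hy => ?_, fun y _ => hU8 ⊥ y (Or.inl rfl)⟩
  have hye : ¬ y ≤ e := fun h => hy ⟨bot_le, h⟩
  by_cases hey : e ≤ y
  · rcases eq_or_ne y ⊤ with rfl | hy1
    · have hxe : ¬ e ≤ x := hx.2.not_ge
      refine hU0 x ⊤ (fun h => hye h.2.2) (fun h => he1 h.2.symm) (fun h => hx.2.ne h.1)
        (fun h => hxe h.1.1.le) (fun h => h.2.2.ne rfl) (fun h => h.1.1 hx.2.le)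
        (fun h => h.2.2 le_top) ?_
      rintro (h | h)
      · exact hx.1.ne' h
      · exact hye (h.le.trans bot_le)
    · have hyI : y ∈ Set.Ioo e ⊤ := ⟨lt_of_le_not_ge hey hye, hy1.lt_top⟩
      rw [hU5 x y ⟨hx, hyI⟩, inf_eq_right.2 hey]
      have hle : int₁ y ⊔ e ≤ y := sup_le (hint₁_le y) hey
      have hlt : e < int₁ y ⊔ e :=
        right_lt_sup.2 fun h => hint₁cond y hyI ⟨bot_le, h⟩
      exact antichain_Ioo _ ⟨hlt, hle.trans_lt hyI.2⟩ y hyI hle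
  · have hyP : Par y e := ⟨hye, hey⟩
    have hiP : Par (int₂ y) e :=
      ⟨fun h => hint₂cond y hyP ⟨bot_le, h⟩, fun h => hey (h.trans (hint₂_le y))⟩
    rw [hU7 x y ⟨hx, hyP⟩, antichain_Par _ y hiP hyP (hint₂_le y), sup_inf_self]
end
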